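/- arXiv:2506.04412 — 2 statements merged into one kernel-verified Lean document; each statement's English description precedes it below -/
import Mathlib

section
/- Let X be a complex Banach space of dimension at least three and let A, B ∈ B(X). Suppose that for every operator Y that is a rank-one idempotent or a rank-one anti-idempotent: A∘Y is a nonzero idempotent if and only if B∘Y is a nonzero idempotent, and A∘Y = 0 if and only if B∘Y = 0. If at least one of A, B is tripotent (i.e., A³ = A or B³ = B), then A = B. -/
lemma aux_char {X : Type*} [NormedAddCommGroup X] [NormedSpace ℂ X]
    (A : X →L[ℂ] X) (x : X) (f : X →L[ℂ] ℂ) (hfx : f x = 1) :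
    (IsIdempotentElem ((2⁻¹ : ℂ) • (A * f.smulRight x + f.smulRight x * A)) ∧
      (2⁻¹ : ℂ) • (A * f.smulRight x + f.smulRight x * A) ≠ 0) ↔
      (A x = x ∨ ∀ y, f (A y) = f y) := by
  set T := (2⁻¹ : ℂ) • (A * f.smulRight x + f.smulRight x * A) with hT
  have hTy : ∀ y, T y = (2⁻¹ : ℂ) • (f y • A x + f (A y) • x) := by
    intro y; simp [hT]
  constructor
  · rintro ⟨hi, hne⟩
    have hi' : ∀ y, T (T y) = T y := fun y => by
      have := congrArg (fun S : X →L[ℂ] X => S y) hi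
      simpa using this
    by_cases hl : ∃ l : ℂ, A x = l • x
    · obtain ⟨l, hl⟩ := hl
      left
      have hex : ∃ y, T y ≠ 0 := by
        by_contra hcon
        push Not at hcon
        exact hne (ContinuousLinearMap.ext hcon)
      obtain ⟨y, hy⟩ := hex
      have h3 : T y = (2⁻¹ * (f y * l + f (A y))) • x := by
        rw [hTy, hl]; module
      have h4 : T x = l • x := by
        rw [hTy, hl]; simp [hfx, hl]; module
      have h5 := hi' y
      rw [h3, map_smul, h4] at h5
      have h6 : (2⁻¹ * (f y * l + f (A y))) • (l • x - x) = 0 := by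
        rw [smul_sub, h5, sub_self]
      rcases smul_eq_zero.1 h6 with h | h
      · exact absurd (by rw [h3, h, zero_smul]) hy
      · rw [hl]; exact sub_eq_zero.1 h
    · right
      have key : ∀ a b : ℂ, a • A x + b • x = 0 → a = 0 ∧ b = 0 := by
        intro a b hab
        have ha : a = 0 := by
          by_contra ha
          apply hl
          refine ⟨-(a⁻¹ * b), ?_⟩
          have : a⁻¹ • (a • A x + b • x) = 0 := by rw [hab, smul_zero]
          rw [smul_add, smul_smul, inv_mul_cancel₀ ha, one_smul, smul_smul] at this
          rw [neg_smul]; exact eq_neg_of_add_eq_zero_left this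
        refine ⟨ha, ?_⟩
        rw [ha, zero_smul, zero_add] at hab
        rcases smul_eq_zero.1 hab with h | h
        · exact h
        · rw [h] at hfx; simp at hfx
      have e : ∀ y, T (T y) = (4⁻¹ : ℂ) • ((f y * f (A x) + f (A y)) • A x
          + (f y * f (A (A x)) + f (A y) * f (A x)) • x) := by
        intro y
        rw [hTy (T y), hTy y]
        simp only [map_smul, map_add, smul_eq_mul, hfx]
        module
      have e2 : ∀ y, f y * f (A x) + f (A y) - 2 * f y = 0 ∧
          f y * f (A (A x)) + f (A y) * f (A x) - 2 * f (A y) = 0 := by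
        intro y
        apply key
        have h5 := hi' y
        rw [e, hTy] at h5
        have h6 := congrArg (fun v => (4 : ℂ) • v) h5
        rw [← sub_eq_zero] at h6
        rw [← h6]; module
      have ha := (e2 x).1
      rw [hfx] at ha
      have ha' : f (A x) = 1 := by linear_combination ha / 2
      intro y
      have := (e2 y).1
      rw [ha'] at this
      linear_combination this
  · intro h
    have hfT : T x ≠ 0 → T ≠ 0 := by
      intro h h0; rw [h0] at h; simp at h
    rcases h with h | h
    · have h3 : ∀ y, T y = (2⁻¹ * (f y + f (A y))) • x := by
        intro y; rw [hTy, h]; module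
      have h4 : T x = x := by rw [h3, h, hfx]; norm_num
      refine ⟨?_, hfT ?_⟩
      · ext y
        change T (T y) = T y
        rw [h3 y, map_smul, h4]
      · rw [h4]; rintro rfl; simp at hfx
    · have h3 : ∀ y, T y = f y • ((2⁻¹ : ℂ) • (A x + x)) := by
        intro y; rw [hTy, h]; module
      have h4 : ∀ y, f (T y) = f y := by
        intro y; rw [h3]; simp [h, hfx]; ring
      refine ⟨?_, hfT ?_⟩
      · ext y
        change T (T y) = T y
        rw [h3 (T y), h4, ← h3]
      · intro h0
        have := h4 x
        rw [h0, hfx] at this; simp at this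

lemma aux_zero {X : Type*} [NormedAddCommGroup X] [NormedSpace ℂ X]
    (A : X →L[ℂ] X) (x : X) (f : X →L[ℂ] ℂ) (hfx : f x = 1) :
    (2⁻¹ : ℂ) • (A * f.smulRight x + f.smulRight x * A) = 0 ↔
      (A x = 0 ∧ ∀ y, f (A y) = 0) := by
  constructor
  · intro h
    have h' : ∀ y, f y • A x + f (A y) • x = 0 := by
      intro y
      have := congrArg (fun S : X →L[ℂ] X => S y) h
      have this : (2⁻¹ : ℂ) • (A (f y • x) + f (A y) • x) = 0 := this
      rw [map_smul] at this
      exact (smul_eq_zero.1 this).resolve_left (by norm_num)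
    have hx := h' x
    have ha : f (A x) = 0 := by
      have := congrArg f hx
      simp only [map_add, map_smul, hfx, smul_eq_mul, map_zero] at this
      linear_combination this / 2
    have hA : A x = 0 := by simpa [ha, hfx] using hx
    refine ⟨hA, fun y => ?_⟩
    have := congrArg f (h' y)
    simpa [hA, hfx] using this
  · rintro ⟨h, h'⟩
    ext y
    simp [h, h']

lemma aux_rank {X : Type*} [NormedAddCommGroup X] [NormedSpace ℂ X]
    (x : X) (f : X →L[ℂ] ℂ) (hfx : f x = 1) (c : ℂ) (hc : c ≠ 0) :
    LinearMap.rank ((c • f.smulRight x : X →L[ℂ] X) : X →ₗ[ℂ] X) = 1 := by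
  have hx : x ≠ 0 := by rintro rfl; simp at hfx
  have : LinearMap.range ((c • f.smulRight x : X →L[ℂ] X) : X →ₗ[ℂ] X) = ℂ ∙ x := by
    ext y
    rw [LinearMap.mem_range, Submodule.mem_span_singleton]
    constructor
    · rintro ⟨z, rfl⟩
      exact ⟨c * f z, by simp [smul_smul]⟩
    · rintro ⟨a, rfl⟩
      refine ⟨(c⁻¹ * a) • x, ?_⟩
      simp [hfx, smul_smul]
      congr 1
      field_simp
  rw [LinearMap.rank, this]
  rw [rank_submodule_eq_one_iff]
  exact ⟨x, Submodule.mem_span_singleton_self x, hx, le_rfl⟩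

lemma aux_eig {X : Type*} [NormedAddCommGroup X] [NormedSpace ℂ X]
    (A B : X →L[ℂ] X)
    (H : ∀ (x : X) (f : X →L[ℂ] ℂ), f x = 1 → (A x = x ∨ ∀ y, f (A y) = f y) →
      (B x = x ∨ ∀ y, f (B y) = f y)) (x : X) (hx : A x = x) : B x = x := by
  by_contra hB
  have hx0 : x ≠ 0 := by rintro rfl; simp at hB
  have hall : ∀ f : X →L[ℂ] ℂ, f x = 1 → f (B x - x) = 0 := by
    intro f hf
    have := ((H x f hf (Or.inl hx)).resolve_left hB) x
    rw [map_sub, this, sub_self]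
  obtain ⟨g, hg⟩ := SeparatingDual.exists_eq_one (R := ℂ) hx0
  obtain ⟨h, hh⟩ := SeparatingDual.exists_eq_one (R := ℂ) (sub_ne_zero.2 hB)
  have h1 := hall g hg
  have h2 := hall (g + (h - h x • g)) (by simp [hg])
  simp only [ContinuousLinearMap.add_apply, ContinuousLinearMap.sub_apply,
    ContinuousLinearMap.smul_apply, h1, hh] at h2
  simp at h2

lemma aux_main {X : Type*} [NormedAddCommGroup X] [NormedSpace ℂ X]
    (A B : X →L[ℂ] X)
    (h1 : ∀ Y : X →L[ℂ] X,
      (LinearMap.rank (Y : X →ₗ[ℂ] X) = 1 ∧ (Y * Y = Y ∨ Y * Y = -Y)) →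
      ((IsIdempotentElem ((2⁻¹ : ℂ) • (A * Y + Y * A)) ∧
          (2⁻¹ : ℂ) • (A * Y + Y * A) ≠ 0) ↔
        (IsIdempotentElem ((2⁻¹ : ℂ) • (B * Y + Y * B)) ∧
          (2⁻¹ : ℂ) • (B * Y + Y * B) ≠ 0)))
    (h2 : ∀ Y : X →L[ℂ] X,
      (LinearMap.rank (Y : X →ₗ[ℂ] X) = 1 ∧ (Y * Y = Y ∨ Y * Y = -Y)) →
      ((2⁻¹ : ℂ) • (A * Y + Y * A) = 0 ↔ (2⁻¹ : ℂ) • (B * Y + Y * B) = 0))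
    (htri : A * A * A = A) : A = B := by
  have hP : ∀ (x : X) (f : X →L[ℂ] ℂ), f x = 1 →
      f.smulRight x * f.smulRight x = f.smulRight x := by
    intro x f hf; ext y; simp [hf]
  have hr : ∀ (x : X) (f : X →L[ℂ] ℂ), f x = 1 →
      LinearMap.rank ((f.smulRight x : X →L[ℂ] X) : X →ₗ[ℂ] X) = 1 := by
    intro x f hf
    have := aux_rank x f hf 1 one_ne_zero
    rwa [one_smul] at this
  have hrn : ∀ (x : X) (f : X →L[ℂ] ℂ), f x = 1 →
      LinearMap.rank ((-f.smulRight x : X →L[ℂ] X) : X →ₗ[ℂ] X) = 1 := by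
    intro x f hf
    have := aux_rank x f hf (-1) (by norm_num)
    rwa [neg_one_smul] at this
  have E1 : ∀ x, A x = x → B x = x := by
    apply aux_eig
    intro x f hf
    rw [← aux_char A x f hf, ← aux_char B x f hf]
    exact (h1 _ ⟨hr x f hf, Or.inl (hP x f hf)⟩).1
  have E2 : ∀ x, (-A) x = x → (-B) x = x := by
    apply aux_eig
    intro x f hf
    rw [← aux_char (-A) x f hf, ← aux_char (-B) x f hf]
    have := (h1 _ ⟨hrn x f hf, Or.inr (by rw [neg_mul_neg, neg_neg, hP x f hf])⟩).1
    simpa only [mul_neg, neg_mul] using this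
  have hA3 : ∀ x, A (A (A x)) = A x := fun x => by
    have := congrArg (fun S : X →L[ℂ] X => S x) htri
    simpa using this
  have E0 : ∀ x, A x = 0 → B x = 0 := by
    intro x hx
    by_cases hx0 : x = 0
    · simp [hx0]
    obtain ⟨g, hg⟩ := SeparatingDual.exists_eq_one (R := ℂ) hx0
    let f : X →L[ℂ] ℂ := g - g.comp (A * A)
    have hfv : ∀ y, f y = g y - g (A (A y)) := fun y => by simp [f]
    have hf : f x = 1 := by rw [hfv, hx]; simp [hg]
    have := (h2 _ ⟨hr x f hf, Or.inl (hP x f hf)⟩)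
    rw [aux_zero A x f hf, aux_zero B x f hf] at this
    exact (this.1 ⟨hx, fun y => by rw [hfv, hA3, sub_self]⟩).1
  ext x
  have k1 := E1 (A (A x) + A x) (by rw [map_add, hA3, add_comm])
  have k2 := E2 (A (A x) - A x) (by
    rw [ContinuousLinearMap.neg_apply, map_sub, hA3, neg_sub])
  have k0 := E0 (x - A (A x)) (by rw [map_sub, hA3, sub_self])
  rw [ContinuousLinearMap.neg_apply] at k2
  rw [map_add] at k1
  rw [map_sub] at k2 k0
  have e1 : B x = B (A (A x)) := sub_eq_zero.1 k0
  have e2 : (2 : ℂ) • B (A (A x)) = (2 : ℂ) • A x := by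
    have e3 : (2 : ℂ) • B (A (A x)) = (B (A (A x)) + B (A x)) - -(B (A (A x)) - B (A x)) := by
      module
    rw [e3, k1, k2]; module
  rw [e1]
  exact (smul_right_injective X (two_ne_zero : (2 : ℂ) ≠ 0) e2).symm


theorem stmt_15 {X : Type*} [NormedAddCommGroup X] [NormedSpace ℂ X] [CompleteSpace X]
    (hdim : 3 ≤ Module.rank ℂ X)
    (A B : X →L[ℂ] X)
    (h1 : ∀ Y : X →L[ℂ] X,
      (LinearMap.rank (Y : X →ₗ[ℂ] X) = 1 ∧ (Y * Y = Y ∨ Y * Y = -Y)) →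
      ((IsIdempotentElem ((2⁻¹ : ℂ) • (A * Y + Y * A)) ∧
          (2⁻¹ : ℂ) • (A * Y + Y * A) ≠ 0) ↔
        (IsIdempotentElem ((2⁻¹ : ℂ) • (B * Y + Y * B)) ∧
          (2⁻¹ : ℂ) • (B * Y + Y * B) ≠ 0)))
    (h2 : ∀ Y : X →L[ℂ] X,
      (LinearMap.rank (Y : X →ₗ[ℂ] X) = 1 ∧ (Y * Y = Y ∨ Y * Y = -Y)) →
      ((2⁻¹ : ℂ) • (A * Y + Y * A) = 0 ↔ (2⁻¹ : ℂ) • (B * Y + Y * B) = 0))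
    (htri : A * A * A = A ∨ B * B * B = B) :
    A = B := by
  rcases htri with h | h
  · exact aux_main A B h1 h2 h
  · exact (aux_main B A (fun Y hY => (h1 Y hY).symm) (fun Y hY => (h2 Y hY).symm) h).symm
end

section
/- Let X be a complex Banach space of dimension at least three and let A, B ∈ B(X). Then A = B if and only if for every Y ∈ B(X), A∘Y is idempotent if and only if B∘Y is idempotent. -/
open Polynomial

section Aux
variable {X : Type*} [NormedAddCommGroup X] [NormedSpace ℂ X]

/-- The doubled form of the hypothesis. -/
def JH (A B : X →L[ℂ] X) : Prop := ∀ Y : X →L[ℂ] X,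
  (A * Y + Y * A) * (A * Y + Y * A) = (2 : ℂ) • (A * Y + Y * A) ↔
  (B * Y + Y * B) * (B * Y + Y * B) = (2 : ℂ) • (B * Y + Y * B)

lemma idem_iff (T : X →L[ℂ] X) :
    IsIdempotentElem ((2⁻¹ : ℂ) • T) ↔ T * T = (2 : ℂ) • T := by
  unfold IsIdempotentElem
  rw [smul_mul_smul_comm]
  constructor
  · intro h
    have := congrArg (fun S => (4 : ℂ) • S) h
    simp only [smul_smul] at this
    norm_num at this
    exact this
  · intro h
    rw [h, smul_smul]; norm_num

lemma JH.symm {A B : X →L[ℂ] X} (h : JH A B) : JH B A := fun Y => (h Y).symm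

lemma JH.zero {A B : X →L[ℂ] X} (h : JH A B) {Y : X →L[ℂ] X} (hY : A * Y + Y * A = 0) :
    B * Y + Y * B = 0 := by
  have h1 := (h Y).1 (by rw [hY]; simp)
  have h2 := (h ((2 : ℂ) • Y)).1 (by
    have : A * ((2 : ℂ) • Y) + ((2 : ℂ) • Y) * A = 0 := by
      rw [mul_smul_comm, smul_mul_assoc, ← smul_add, hY, smul_zero]
    rw [this]; simp)
  have h3 : B * ((2 : ℂ) • Y) + ((2 : ℂ) • Y) * B = (2 : ℂ) • (B * Y + Y * B) := by
    rw [mul_smul_comm, smul_mul_assoc, ← smul_add]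
  rw [h3, smul_mul_smul_comm, h1, smul_smul, smul_smul] at h2
  have h4 : ((2 * 2 * 2 - 2 * 2 : ℂ)) • (B * Y + Y * B) = 0 := by
    rw [sub_smul, h2, sub_self]
  rcases smul_eq_zero.1 h4 with h5 | h5
  · norm_num at h5
  · exact h5

lemma rk_apply (A : X →L[ℂ] X) (f : X →L[ℂ] ℂ) (x y : X) :
    (A * f.smulRight x + f.smulRight x * A) y = f y • A x + f (A y) • x := by
  simp

/-- The idempotent equation evaluated at a point, for rank one `Y`. -/
lemma rk_idem (B : X →L[ℂ] X) (f : X →L[ℂ] ℂ) (x : X)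
    (h : (B * f.smulRight x + f.smulRight x * B) * (B * f.smulRight x + f.smulRight x * B)
      = (2 : ℂ) • (B * f.smulRight x + f.smulRight x * B)) (y : X) :
    (f y * f (B x) + f (B y) * f x) • B x + (f y * f (B (B x)) + f (B y) * f (B x)) • x
      = (2 * f y) • B x + (2 * f (B y)) • x := by
  have := congrArg (fun T : X →L[ℂ] X => T y) h
  simp only [mul_apply_eq_comp, rk_apply, smul_apply] at this
  simpa [smul_smul] using this

/-- basic rank one information -/
lemma JH.basic {A B : X →L[ℂ] X} (h : JH A B) {x : X} {f : X →L[ℂ] ℂ}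
    (h0 : f x = 0) (h2 : f (A (A x)) = 0) (h1 : f (A x) = 2) :
    f (B x) = 2 ∧ f (B (B x)) = 0 := by
  have hx : x ≠ 0 := by rintro rfl; simp at h1
  have hB := (h (f.smulRight x)).1 (by
    ext y
    simp only [mul_apply_eq_comp, rk_apply, smul_apply]
    simp only [map_add, map_smul, h0, h1, h2]
    simp [smul_smul, mul_comm])
  have hBy := rk_idem B f x hB
  have e1 : (f (B x) * f (B x)) • x = (2 * f (B x)) • x := by
    simpa [h0] using hBy x
  have e1' := smul_left_injective ℂ hx e1
  by_cases hc : f (B x) = 0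
  · exfalso
    have hz : B * f.smulRight x + f.smulRight x * B = 0 := by
      have sq : ∀ y, (f y * f (B (B x))) • x = (2:ℂ) • (f y • B x + f (B y) • x) := by
        intro y; have := hBy y; simp only [hc, h0] at this
        simp only [smul_add, smul_smul]; simpa using this
      have hk : f (B (B x)) = 0 := by
        have t3 := (sq (B x)).symm
        rw [hc, zero_smul, zero_add, zero_mul, zero_smul, smul_smul] at t3
        simpa [hx] using t3
      ext y
      rw [rk_apply]
      have s1 := (sq y).symm
      rw [hk, mul_zero, zero_smul] at s1
      exact (smul_eq_zero.1 s1).resolve_left two_ne_zero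
    have := congrArg (fun T : X →L[ℂ] X => T x) (h.symm.zero hz)
    simp only [rk_apply, h0, h1] at this
    simp [hx] at this
  · have hc2 : f (B x) = 2 := mul_right_cancel₀ hc e1'
    refine ⟨hc2, ?_⟩
    have := hBy (B x)
    rw [hc2, h0] at this
    have e : (2 * f (B (B x))) • x = 0 := by
      have e3 : (2 * f (B (B x)) + f (B (B x)) * 2) • x = (2 * f (B (B x))) • x := by
        have e4 : (2 * 2 + f (B (B x)) * 0 : ℂ) • B x = (2*2 : ℂ) • B x := by simp
        rw [e4] at this
        exact add_left_cancel this
      rw [add_smul, mul_comm (f (B (B x))) 2] at e3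
      simpa using e3
    simpa [hx] using e

lemma JH.basic' {A B : X →L[ℂ] X} (h : JH A B) {x : X} {f : X →L[ℂ] ℂ}
    (h0 : f x = 0) (h2 : f (A (A x)) = 0) (h1 : f (A x) ≠ 0) :
    f (B x) = f (A x) ∧ f (B (B x)) = 0 := by
  have := h.basic (x := x) (f := (2 / f (A x)) • f) (by simp [h0]) (by simp [h2])
    (by simp; field_simp)
  simp only [smul_apply, smul_eq_mul] at this
  obtain ⟨a, b⟩ := this
  constructor
  · field_simp at a; exact a
  · simpa [h1] using b

lemma JH.basicD {A B : X →L[ℂ] X} (h : JH A B) {x : X} {f : X →L[ℂ] ℂ}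
    (h0 : f x = 0) (h2 : f (A (A x)) = 0) (h1 : f (A x) ≠ 0) :
    f ((B - A) x) = 0 := by
  simp [(h.basic' h0 h2 h1).1]

/-- Hahn-Banach separation from a finite dimensional subspace. -/
lemma hb_sep (W : Submodule ℂ X) [FiniteDimensional ℂ W] (v : X) (hv : v ∉ W) :
    ∃ f : X →L[ℂ] ℂ, (∀ w ∈ W, f w = 0) ∧ f v = 1 := by
  obtain ⟨f, hf, hW⟩ := Submodule.exists_le_ker_of_notMem hv
  let V : Submodule ℂ X := W ⊔ Submodule.span ℂ {v}
  let f' : V →L[ℂ] ℂ := LinearMap.toContinuousLinearMap (f.comp V.subtype)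
  obtain ⟨g, hg, -⟩ := exists_extension_norm_eq V f'
  have hgv : g v = f v := hg ⟨v, Submodule.mem_sup_right (Submodule.mem_span_singleton_self v)⟩
  refine ⟨(f v)⁻¹ • g, fun w hw => ?_, ?_⟩
  · have hgw : g w = f w := hg ⟨w, Submodule.mem_sup_left hw⟩
    have : f w = 0 := hW hw
    simp [hgw, this]
  · simp [hgv, hf]

lemma hb_mem (W : Submodule ℂ X) [FiniteDimensional ℂ W] {w v : X} (hw : w ∉ W)
    (h : ∀ f : X →L[ℂ] ℂ, (∀ u ∈ W, f u = 0) → f w ≠ 0 → f v = 0) : v ∈ W := by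
  by_contra hv
  obtain ⟨f, hf, hfv⟩ := hb_sep W v hv
  obtain ⟨g, hg, hgw⟩ := hb_sep W w hw
  have e1 : f w = 0 := by
    by_contra hne
    rw [h f hf hne] at hfv; exact zero_ne_one hfv
  have e2 : g v = 0 := h g hg (by rw [hgw]; exact one_ne_zero)
  have := h (f + g) (fun u hu => by simp [hf u hu, hg u hu]) (by simp [e1, hgw])
  simp [hfv, e2] at this

/-- Eigenvectors are shared. -/
lemma JH.eig {A B : X →L[ℂ] X} (h : JH A B) {x : X} {l : ℂ} (hl : l ≠ 0) (hx : A x = l • x) :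
    B x = l • x := by
  by_cases hx0 : x = 0
  · simp [hx0]
  have key : ∀ f : X →L[ℂ] ℂ, f x = l⁻¹ →
      (B * f.smulRight x + f.smulRight x * B) * (B * f.smulRight x + f.smulRight x * B)
      = (2 : ℂ) • (B * f.smulRight x + f.smulRight x * B) := by
    intro f hf
    refine (h (f.smulRight x)).1 ?_
    ext y
    simp only [mul_apply_eq_comp, rk_apply, smul_apply]
    simp only [map_add, map_smul, hx, hf, smul_smul, smul_eq_mul, ← add_smul]
    congr 1
    field_simp
    ring
  have key2 : ∃ n : ℂ, B x = n • x := by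
    by_contra hcon
    have hB : B x ∉ Submodule.span ℂ {x} := by
      intro hm; obtain ⟨n, hn⟩ := Submodule.mem_span_singleton.1 hm
      exact hcon ⟨n, hn.symm⟩
    have hxB : x ∉ Submodule.span ℂ {B x} := by
      intro hm; obtain ⟨n, hn⟩ := Submodule.mem_span_singleton.1 hm
      have : n ≠ 0 := by rintro rfl; simp at hn; exact hx0 hn.symm
      exact hcon ⟨n⁻¹, by
        have := congrArg (fun v => n⁻¹ • v) hn
        simpa [smul_smul, inv_mul_cancel₀ ‹n ≠ 0›] using this⟩
    obtain ⟨g, hg, hgx⟩ := hb_sep _ x hxB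
    obtain ⟨g', hg', hgx'⟩ := hb_sep _ (B x) hB
    have hgB : g (B x) = 0 := hg _ (Submodule.mem_span_singleton_self _)
    have hgx0 : g' x = 0 := hg' _ (Submodule.mem_span_singleton_self _)
    have e := rk_idem B (l⁻¹ • g) x (key _ (by simp [hgx])) x
    have e' := congrArg g' e
    simp [hgB, hgx, hgx', hgx0, hl] at e'
  obtain ⟨n, hn⟩ := key2
  obtain ⟨g, -, hgx⟩ := hb_sep (⊥ : Submodule ℂ X) x (by simpa using hx0)
  have e := rk_idem B (l⁻¹ • g) x (key _ (by simp [hgx]))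
  by_cases hn0 : n = 0
  · exfalso
    have hBx : B x = 0 := by rw [hn, hn0, zero_smul]
    have hz : B * (l⁻¹ • g).smulRight x + (l⁻¹ • g).smulRight x * B = 0 := by
      ext y
      have := e y
      rw [rk_apply]
      have t := this.symm
      simp only [hBx, map_zero, smul_zero, mul_zero, zero_add, add_zero, zero_smul, mul_smul] at t
      rw [hBx, smul_zero, zero_add]
      exact (smul_eq_zero.1 t).resolve_left two_ne_zero
    have := congrArg (fun T : X →L[ℂ] X => T x) (h.symm.zero hz)
    simp only [rk_apply, hx] at this
    simp [hgx, hl, ← two_smul ℂ x, hx0] at this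
  · have := e x
    simp only [hn, map_smul, smul_smul, ← add_smul] at this
    have := smul_left_injective ℂ hx0 this
    simp [hgx] at this
    field_simp at this
    have h3 : n = l := by linear_combination this / 2
    rw [hn, h3]

/-- Eigenfunctionals are shared. -/
lemma JH.coeig {A B : X →L[ℂ] X} (h : JH A B) {f : X →L[ℂ] ℂ} {l : ℂ} (hl : l ≠ 0)
    (hf : ∀ y, f (A y) = l * f y) (y : X) : f (B y) = l * f y := by
  by_cases hf0 : f = 0
  · simp [hf0]
  have key : ∀ x : X, f x = l⁻¹ →
      (B * f.smulRight x + f.smulRight x * B) * (B * f.smulRight x + f.smulRight x * B)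
      = (2 : ℂ) • (B * f.smulRight x + f.smulRight x * B) := by
    intro x hx
    refine (h (f.smulRight x)).1 ?_
    ext y
    simp only [mul_apply_eq_comp, rk_apply, smul_apply]
    simp only [map_add, map_smul, hf, hx, smul_smul, smul_eq_mul, smul_add]
    congr 2 <;> · field_simp; try ring
  have hex : ∃ x, f x = l⁻¹ := by
    obtain ⟨z, hz⟩ : ∃ z, f z ≠ 0 := by
      by_contra hcon; push Not at hcon; exact hf0 (by ext z; simpa using hcon z)
    exact ⟨(l⁻¹ / f z) • z, by simp; field_simp⟩
  have key2 : ∃ n : ℂ, ∀ y, f (B y) = n * f y := by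
    by_cases hk : ∀ z, f z = 0 → f (B z) = 0
    · obtain ⟨x, hx⟩ := hex
      refine ⟨l * f (B x), fun y => ?_⟩
      have := hk (y - (l * f y) • x) (by simp [hx]; field_simp; ring)
      simp at this
      linear_combination this
    · exfalso
      push Not at hk
      obtain ⟨z, hz, hBz⟩ := hk
      obtain ⟨x, hx⟩ := hex
      have hx' : f (x - (f (B x) / f (B z)) • z) = l⁻¹ := by simp [hz, hx]
      have hx'' : f (B (x - (f (B x) / f (B z)) • z)) = 0 := by simp; field_simp; ring
      generalize x - (f (B x) / f (B z)) • z = x' at hx' hx''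
      have e := congrArg f (rk_idem B f x' (key _ hx') z)
      simp [hx', hx'', hz, hl, hBz] at e
  obtain ⟨n, hn⟩ := key2
  obtain ⟨x, hx⟩ := hex
  have e := rk_idem B f x (key _ hx)
  have e2 : n = 0 ∨ n = l ∨ True := by simp
  have e1 : ∀ y, (f y * (n * l⁻¹) * 2) • (B x + n • x) = (2 * f y) • (B x + n • x) := by
    intro y
    have := e y
    simp only [hn, hx] at this
    rw [smul_add, smul_add, smul_smul, smul_smul]
    convert this using 3 <;> ring
  by_cases hv : B x + n • x = 0
  · exfalso
    have hz : B * f.smulRight x + f.smulRight x * B = 0 := by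
      ext y
      rw [rk_apply, hn, mul_comm, mul_smul, ← smul_add, hv]; simp
    have := congrArg (fun T : X →L[ℂ] X => f (T x)) (h.symm.zero hz)
    simp only [rk_apply, hf] at this
    simp [hx, hf, hl] at this
  · have := smul_left_injective ℂ hv (e1 x)
    simp [hx] at this
    field_simp at this
    rw [hn, this]
end Aux

section Aux
variable {X : Type*} [NormedAddCommGroup X] [NormedSpace ℂ X]

open Topology Filter

def GI (A : X →L[ℂ] X) (m : ℕ) (x : X) : Prop :=
  LinearIndependent ℂ (fun i : Fin m => (A ^ (i : ℕ)) x)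

lemma GI.line {A : X →L[ℂ] X} {m : ℕ} {x : X} (h : GI A m x) (z : X) :
    ∀ᶠ t in 𝓝 (0 : ℂ), GI A m (x + t • z) := by
  have ho := isOpen_setOfPred_linearIndependent (𝕜 := ℂ) (E := X) (ι := Fin m)
  have hc : Continuous (fun t : ℂ => (fun i : Fin m => (A ^ (i : ℕ)) (x + t • z))) := by
    fun_prop
  have := (ho.preimage hc).mem_nhds (x := 0) (by simpa [GI] using h)
  exact this

lemma exists_two {P : ℂ → Prop} (h : ∀ᶠ t in 𝓝 (0 : ℂ), P t) : ∃ t, t ≠ 0 ∧ P t ∧ P (2 * t) := by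
  have h2 : ∀ᶠ t in 𝓝 (0 : ℂ), P (2 * t) := by
    have : Tendsto (fun t : ℂ => 2 * t) (𝓝 0) (𝓝 0) := by
      have : Continuous (fun t : ℂ => 2 * t) := by fun_prop
      simpa using this.tendsto 0
    exact this.eventually h
  have h3 : ∀ᶠ t in 𝓝[≠] (0 : ℂ), t ≠ 0 := eventually_mem_nhdsWithin
  obtain ⟨t, ht, h4⟩ := (h3.and (eventually_nhdsWithin_of_eventually_nhds (h.and h2))).exists
  exact ⟨t, ht, h4⟩

lemma GI.eq_zero {A D : X →L[ℂ] X} {m : ℕ} {x : X} (h : GI A m x)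
    (hD : ∀ y, GI A m y → D y = 0) : D = 0 := by
  ext z
  obtain ⟨t, ht, h1, -⟩ := exists_two (h.line z)
  have := hD _ h1
  rw [map_add, hD x h, zero_add, map_smul] at this
  simpa [ht] using this

lemma GI.mono {A : X →L[ℂ] X} {m n : ℕ} {x : X} (h : GI A n x) (hmn : m ≤ n) : GI A m x :=
  LinearIndependent.comp h (Fin.castLE hmn) (Fin.castLE_injective hmn)

lemma GI.two {A : X →L[ℂ] X} {x : X} (h : GI A 2 x) {a b : ℂ}
    (e : a • x + b • A x = 0) : a = 0 ∧ b = 0 := by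
  have := Fintype.linearIndependent_iff.1 h ![a, b] (by simpa [Fin.sum_univ_succ] using e)
  exact ⟨this 0, this 1⟩

lemma GI.three {A : X →L[ℂ] X} {x : X} (h : GI A 3 x) {a b c : ℂ}
    (e : a • x + b • A x + c • A (A x) = 0) : a = 0 ∧ b = 0 ∧ c = 0 := by
  have := Fintype.linearIndependent_iff.1 h ![a, b, c] (by
    simpa [Fin.sum_univ_succ, pow_succ, add_assoc] using e)
  exact ⟨this 0, this 1, this 2⟩

lemma GI.four {A : X →L[ℂ] X} {x : X} (h : GI A 4 x) {a b c d : ℂ}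
    (e : a • x + b • A x + c • A (A x) + d • A (A (A x)) = 0) :
    a = 0 ∧ b = 0 ∧ c = 0 ∧ d = 0 := by
  have := Fintype.linearIndependent_iff.1 h ![a, b, c, d] (by
    simpa [Fin.sum_univ_succ, pow_succ, add_assoc] using e)
  exact ⟨this 0, this 1, this 2, this 3⟩

lemma GI.five {A : X →L[ℂ] X} {x : X} (h : GI A 5 x) {a b c d e' : ℂ}
    (e : a • x + b • A x + c • A (A x) + d • A (A (A x)) + e' • A (A (A (A x))) = 0) :
    a = 0 ∧ b = 0 ∧ c = 0 ∧ d = 0 ∧ e' = 0 := by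
  have := Fintype.linearIndependent_iff.1 h ![a, b, c, d, e'] (by
    simpa [Fin.sum_univ_succ, pow_succ, add_assoc] using e)
  exact ⟨this 0, this 1, this 2, this 3, this 4⟩

lemma GI.poly {A : X →L[ℂ] X} {m : ℕ} {x : X} :
    GI A m x ↔ ∀ r : ℂ[X], r.degree < m → aeval A r x = 0 → r = 0 := by
  unfold GI
  rw [Fintype.linearIndependent_iff]
  constructor
  · intro h r hr h0
    by_contra hr0
    have hn : r.natDegree < m := (natDegree_lt_iff_degree_lt hr0).2 hr
    have := h (fun i => r.coeff i) (by
      rw [aeval_eq_sum_range' hn] at h0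
      rw [Fin.sum_univ_eq_sum_range (fun i => r.coeff i • (A ^ i) x) m]
      simpa using h0)
    apply hr0
    ext i
    by_cases hi : i < m
    · simpa using this ⟨i, hi⟩
    · simpa using coeff_eq_zero_of_natDegree_lt (by omega : r.natDegree < i)
  · intro h g hg i
    have := h (∑ i : Fin m, C (g i) * Polynomial.X ^ (i : ℕ)) (degree_sum_fin_lt g) (by
      simpa [Algebra.smul_def] using hg)
    have h2 := congrArg (fun q : ℂ[X] => q.coeff i) this
    simpa [coeff_X_pow, Fin.val_inj] using h2

/-- Range lemma. -/
lemma JH.range {A B : X →L[ℂ] X} (h : JH A B) {x : X}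
    (hx : A x ∉ Submodule.span ℂ {x, A (A x)}) :
    (∃ a b : ℂ, (B - A) x = a • x + b • A (A x)) ∧ (∃ a b : ℂ, B (B x) = a • x + b • A (A x)) := by
  have : FiniteDimensional ℂ (Submodule.span ℂ {x, A (A x)}) :=
    FiniteDimensional.span_of_finite ℂ (by simp)
  have hx1 : x ∈ Submodule.span ℂ {x, A (A x)} := Submodule.subset_span (by simp)
  have hx2 : A (A x) ∈ Submodule.span ℂ {x, A (A x)} := Submodule.subset_span (by simp)
  constructor
  · have := hb_mem _ hx (v := (B - A) x) (fun f hf hw => h.basicD (hf _ hx1) (hf _ hx2) hw)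
    obtain ⟨a, b, e⟩ := Submodule.mem_span_pair.1 this
    exact ⟨a, b, e.symm⟩
  · have := hb_mem _ hx (v := B (B x)) (fun f hf hw => (h.basic' (hf _ hx1) (hf _ hx2) hw).2)
    obtain ⟨a, b, e⟩ := Submodule.mem_span_pair.1 this
    exact ⟨a, b, e.symm⟩

lemma GI.notMem {A : X →L[ℂ] X} {x : X} (h : GI A 3 x) :
    A x ∉ Submodule.span ℂ {x, A (A x)} := by
  intro hm
  obtain ⟨a, b, e⟩ := Submodule.mem_span_pair.1 hm
  have := h.three (a := a) (b := -1) (c := b) (by linear_combination (norm := module) e)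
  exact absurd this.2.1 (by norm_num)

/-- Commutation at generic vectors. -/
lemma JH.comm_at {A B : X →L[ℂ] X} (h : JH A B) {x : X} (hx : GI A 3 x) :
    (B - A) (A x) = A ((B - A) x) := by
  obtain ⟨⟨a, b, e⟩, -⟩ := h.range hx.notMem
  set D := B - A with hD
  have : FiniteDimensional ℂ (Submodule.span ℂ {x, A x}) :=
    FiniteDimensional.span_of_finite ℂ (by simp)
  have hx1 : x ∈ Submodule.span ℂ {x, A x} := Submodule.subset_span (by simp)
  have hx2 : A x ∈ Submodule.span ℂ {x, A x} := Submodule.subset_span (by simp)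
  have hw : A (A x) ∉ Submodule.span ℂ {x, A x} := by
    intro hm
    obtain ⟨a, b, e⟩ := Submodule.mem_span_pair.1 hm
    have := hx.three (a := a) (b := b) (c := -1) (by linear_combination (norm := module) e)
    exact absurd this.2.2 (by norm_num)
  have hm := hb_mem _ hw (v := D (A x) - b • A (A (A x))) (by
    intro f hf hfw
    have f1 := hf _ hx1
    have f2 := hf _ hx2
    have := h.basicD (x := A x - (f (A (A (A x))) / f (A (A x))) • x) (f := f)
      (by simp [f1, f2]) (by simp; field_simp; ring) (by simp [f2, hfw])
    rw [← hD] at this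
    rw [map_sub, map_smul, e] at this
    simp [f1] at this
    field_simp at this
    simp
    linear_combination this)
  obtain ⟨u, v, e2⟩ := Submodule.mem_span_pair.1 hm
  have hev : ∀ᶠ t in 𝓝 (0 : ℂ), LinearIndependent ℂ ![x, A x, A (A x) + t • A (A (A x))] := by
    have ho := isOpen_setOfPred_linearIndependent (𝕜 := ℂ) (E := X) (ι := Fin 3)
    have hc : Continuous (fun t : ℂ => ![x, A x, A (A x) + t • A (A (A x))]) := by
      refine continuous_pi (fun i => ?_)
      fin_cases i <;> simp <;> fun_prop
    have := (ho.preimage hc).mem_nhds (x := 0) (by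
      have h3 : LinearIndependent ℂ ![x, A x, A (A x)] := by
        have hx' := hx
        unfold GI at hx'
        convert hx' using 1
        ext i; fin_cases i <;> simp [pow_succ]
      simpa using h3)
    exact this
  have step : ∀ t : ℂ, t ≠ 0 → GI A 3 (x + t • A x) →
      LinearIndependent ℂ ![x, A x, A (A x) + t • A (A (A x))] → a + t * u = v := by
    intro t ht hG hL
    obtain ⟨⟨a', b', e'⟩, -⟩ := h.range hG.notMem
    rw [← hD] at e'
    have e3 : D (A x) = b • A (A (A x)) + (u • x + v • A x) := by rw [e2]; abel
    rw [map_add, map_smul, e, e3] at e'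
    have := Fintype.linearIndependent_iff.1 hL ![a + t * u - a', t * v - t * a', b - b'] (by
      simp [Fin.sum_univ_succ] at e' ⊢
      rw [← sub_eq_zero] at e'
      rw [← e']
      module)
    have t0 := this 0
    have t1 := this 1
    simp at t0 t1
    have : v = a' := by
      apply mul_left_cancel₀ ht; linear_combination t1
    linear_combination t0 - this
  obtain ⟨t, ht, h1, h2⟩ := exists_two ((hx.line (A x)).and hev)
  have s1 := step t ht h1.1 h1.2
  have s2 := step (2 * t) (by simpa using ht) h2.1 h2.2
  have hu : u = 0 := by
    apply mul_left_cancel₀ ht; linear_combination s2 - s1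
  have hv : v = a := by rw [hu] at s1; simpa using s1.symm
  have e3 : D (A x) = b • A (A (A x)) + (u • x + v • A x) := by rw [e2]; abel
  rw [e3, e, hu, hv]
  simp [add_comm]

lemma JH.comm {A B : X →L[ℂ] X} (h : JH A B) {x : X} (hx : GI A 3 x) :
    (B - A) * A = A * (B - A) := by
  rw [← sub_eq_zero]
  refine hx.eq_zero (fun y hy => ?_)
  simpa [sub_eq_zero] using h.comm_at hy
end Aux

section Aux
variable {X : Type*} [NormedAddCommGroup X] [NormedSpace ℂ X]

open Topology Filter

lemma aeval_comm_apply (A : X →L[ℂ] X) (p q : ℂ[X]) (x : X) :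
    aeval A (p * q) x = aeval A p (aeval A q x) := by
  simp

lemma GI.dvd {A : X →L[ℂ] X} {m : ℕ} {x : X} (h : GI A m x) {p a : ℂ[X]} (hp : p.Monic)
    (hd : p.natDegree = m) (hpx : aeval A p x = 0) (hax : aeval A a x = 0) : p ∣ a := by
  rw [← modByMonic_eq_zero_iff_dvd hp]
  refine GI.poly.1 h _ ?_ ?_
  · have := degree_modByMonic_lt a hp
    rwa [degree_eq_natDegree hp.ne_zero, hd] at this
  · have e := modByMonic_add_div a p
    have := congrArg (fun q => aeval A q x) e
    simp only [map_add, add_apply] at this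
    rw [mul_comm, aeval_comm_apply, hpx, map_zero, add_zero, hax] at this
    exact this

lemma exists_monic {A : X →L[ℂ] X} {m : ℕ} {x : X} (h : GI A m x) (h' : ¬ GI A (m + 1) x) :
    ∃ p : ℂ[X], p.Monic ∧ p.natDegree = m ∧ aeval A p x = 0 := by
  rw [GI.poly] at h'
  push Not at h'
  obtain ⟨r, hr, hrx, hr0⟩ := h'
  have hle : r.natDegree ≤ m := by
    have := (natDegree_lt_iff_degree_lt hr0).2 hr
    omega
  have hge : ¬ r.natDegree < m := fun hlt =>
    hr0 (GI.poly.1 h r ((natDegree_lt_iff_degree_lt hr0).1 hlt) hrx)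
  refine ⟨r * C r.leadingCoeff⁻¹, monic_mul_leadingCoeff_inv hr0, ?_, ?_⟩
  · rw [natDegree_mul_leadingCoeff_inv r hr0]; omega
  · rw [mul_comm, aeval_comm_apply, hrx, map_zero]

/-- Kaplansky-type lemma. -/
lemma kaplansky {A : X →L[ℂ] X} {m : ℕ} {x : X} (h : GI A m x) (h' : ∀ y, ¬ GI A (m + 1) y) :
    ∃ p : ℂ[X], p.Monic ∧ p.natDegree = m ∧ aeval A p = 0 := by
  obtain ⟨p, hp, hd, hpx⟩ := exists_monic h (h' x)
  refine ⟨p, hp, hd, ?_⟩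
  ext z
  obtain ⟨q, hq0, hqz⟩ : ∃ q : ℂ[X], q ≠ 0 ∧ aeval A q z = 0 := by
    have := h' z
    rw [GI.poly] at this
    push Not at this
    obtain ⟨r, -, h1, h2⟩ := this
    exact ⟨r, h2, h1⟩
  have hinf : {t : ℂ | GI A m (x + t • z)}.Infinite :=
    infinite_of_mem_nhds 0 (h.line z)
  choose! P hPm hPd hPx using fun y (hy : GI A m y) => exists_monic hy (h' y)
  have hmap : Set.MapsTo (fun t : ℂ => (P (x + t • z)).roots) {t : ℂ | GI A m (x + t • z)}
      {s : Multiset ℂ | s ≤ (p * q).roots} := by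
    intro t ht
    have ht' : GI A m (x + t • z) := ht
    have : P (x + t • z) ∣ p * q := ht'.dvd (hPm _ ht') (hPd _ ht') (hPx _ ht') (by
      rw [map_add, map_smul, aeval_comm_apply A p q z, hqz, mul_comm p q, aeval_comm_apply, hpx]
      simp)
    exact roots.le_of_dvd (mul_ne_zero hp.ne_zero hq0) this
  have hfin : {s : Multiset ℂ | s ≤ (p * q).roots}.Finite := by
    have := (Multiset.powerset (p * q).roots).toFinset.finite_toSet
    refine this.subset (fun s hs => ?_)
    simpa using hs
  obtain ⟨t, ht, s, hs, hts, he⟩ := hinf.exists_ne_map_eq_of_mapsTo hmap hfin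
  have ht' : GI A m (x + t • z) := ht
  have hs' : GI A m (x + s • z) := hs
  have hP : P (x + t • z) = P (x + s • z) := by
    rw [(IsAlgClosed.splits (P (x + t • z))).eq_prod_roots_of_monic (hPm _ ht'),
      (IsAlgClosed.splits (P (x + s • z))).eq_prod_roots_of_monic (hPm _ hs')]
    rw [he]
  have e1 := hPx _ ht'
  have e2 := hPx _ hs'
  rw [← hP] at e2
  set r := P (x + t • z)
  rw [map_add, map_smul] at e1 e2
  have e3 : (t - s) • aeval A r z = 0 := by linear_combination (norm := module) e1 - e2
  have e4 : aeval A r z = 0 := (smul_eq_zero.1 e3).resolve_left (sub_ne_zero.2 hts)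
  rw [e4, smul_zero, add_zero] at e1
  obtain ⟨c, hc⟩ := h.dvd hp hd hpx e1
  have : r = p := by
    have hdv := h.dvd hp hd hpx e1
    have hdv2 := h.dvd (hPm _ ht') (hPd _ ht') e1 hpx
    exact eq_of_monic_of_associated (hPm _ ht') hp (associated_of_dvd_dvd hdv2 hdv)
  rw [← this, e4]; simp

/-- eigenvectors in cyclic subspaces -/
lemma exists_eig {A : X →L[ℂ] X} {w : X} (hw : w ≠ 0) (n : ℕ) : ∀ {p : ℂ[X]}, p ≠ 0 →
    p.natDegree = n → aeval A p w = 0 →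
    ∃ (g : ℂ[X]) (l : ℂ), aeval A g w ≠ 0 ∧ A (aeval A g w) = l • aeval A g w := by
  induction n using Nat.strong_induction_on with
  | _ n ih =>
    intro p hp hn hpw
    have hdeg : p.degree ≠ 0 := by
      intro h0
      rw [eq_C_of_degree_eq_zero h0] at hpw hp
      simp [hw] at hpw
      simp [hpw] at hp
    obtain ⟨l, hl⟩ := IsAlgClosed.exists_root p hdeg
    obtain ⟨g, hg⟩ := dvd_iff_isRoot.2 hl
    by_cases hgw : aeval A g w = 0
    · have hg0 : g ≠ 0 := by rintro rfl; simp at hg; exact hp hg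
      refine ih g.natDegree ?_ hg0 rfl hgw
      rw [← hn, hg, natDegree_mul (X_sub_C_ne_zero l) hg0, natDegree_X_sub_C]; omega
    · refine ⟨g, l, hgw, ?_⟩
      rw [hg, aeval_comm_apply] at hpw
      simpa [sub_eq_zero, Algebra.algebraMap_eq_smul_one] using hpw

/-- Drazin inverse of an algebraic element -/
lemma drazin {A : X →L[ℂ] X} {p : ℂ[X]} (hp : p ≠ 0) (hA : aeval A p = 0) :
    ∃ (k : ℕ) (q u : ℂ[X]), p = Polynomial.X ^ k * q ∧
      (A * aeval A u) * (A * aeval A u) = A * aeval A u ∧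
      aeval A u * (A * aeval A u) = aeval A u ∧ A ^ k * (1 - A * aeval A u) = 0 := by
  obtain ⟨q, hq, hX⟩ := exists_eq_pow_rootMultiplicity_mul_and_not_dvd p hp 0
  simp only [map_zero, sub_zero] at hq hX
  set k := rootMultiplicity 0 p
  have hco : IsCoprime (Polynomial.X ^ (k + 1)) q :=
    IsCoprime.pow_left ((irreducible_X.coprime_iff_not_dvd).2 hX)
  obtain ⟨u, v, huv⟩ := hco
  have e0 : A ^ k * aeval A q = 0 := by
    have := hA; rw [hq] at this; simpa using this
  have e1 : aeval A u * A ^ (k + 1) + aeval A v * aeval A q = 1 := by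
    have := congrArg (aeval A) huv; simpa using this
  have cA : ∀ r : ℂ[X], A * aeval A r = aeval A r * A := fun r => by
    have := congrArg (aeval A) (mul_comm Polynomial.X r); simpa using this
  have cc : ∀ r s : ℂ[X], aeval A s * aeval A r = aeval A r * aeval A s := fun r s => by
    have := congrArg (aeval A) (mul_comm s r); simpa using this
  have eE : A * aeval A (u * Polynomial.X ^ k) = 1 - aeval A v * aeval A q := by
    rw [cA, ← e1]; simp [pow_succ, mul_assoc]
  have e2 : A ^ k * (aeval A v * aeval A q) = 0 := by
    have : A ^ k = aeval A (Polynomial.X ^ k : ℂ[X]) := by simp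
    rw [← mul_assoc, this, cc v, mul_assoc, ← this, e0, mul_zero]
  have e3 : aeval A (u * Polynomial.X ^ k) * (A * aeval A (u * Polynomial.X ^ k)) =
      aeval A (u * Polynomial.X ^ k) := by
    rw [eE, mul_sub, mul_one]
    have : aeval A (u * Polynomial.X ^ k) = aeval A u * A ^ k := by simp
    rw [this, mul_assoc, e2, mul_zero, sub_zero]
  refine ⟨k, q, u * Polynomial.X ^ k, hq, ?_, e3, ?_⟩
  · rw [mul_assoc, e3]
  · rw [eE, sub_sub_cancel, e2]
end Aux

section Aux
variable {X : Type*} [NormedAddCommGroup X] [NormedSpace ℂ X]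

open Topology Filter

lemma comm_aeval {A D : X →L[ℂ] X} (hc : D * A = A * D) (g : ℂ[X]) :
    D * aeval A g = aeval A g * D := by
  have h1 : Commute D A := hc
  rw [aeval_eq_sum_range]
  exact Commute.sum_right _ _ _ (fun i _ => (h1.pow_right i).smul_right _)

lemma JH.drazin_zero {A B : X →L[ℂ] X} (h : JH A B) (hc : (B - A) * A = A * (B - A))
    {p : ℂ[X]} (hp : p ≠ 0) (hA : aeval A p = 0) {u : ℂ[X]}
    (hE : (A * aeval A u) * (A * aeval A u) = A * aeval A u)
    (hY : aeval A u * (A * aeval A u) = aeval A u) : (B - A) * (A * aeval A u) = 0 := by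
  have hcY := comm_aeval hc u
  have hAY : A * aeval A u = aeval A u * A := comm_aeval rfl u
  have hcg := fun g : ℂ[X] => comm_aeval hc g
  have hBD : B = A + (B - A) := by abel
  set D := B - A with hD
  set Y := aeval A u with hYdef
  have hcE : D * (A * Y) = (A * Y) * D := by
    rw [← mul_assoc, hc, mul_assoc, hcY, mul_assoc]
  have hEY : (A * Y) * Y = Y := by rw [hAY, mul_assoc, hY]
  have hTA : A * Y + Y * A = (2 : ℂ) • (A * Y) := by rw [← hAY, two_smul]
  have hTB : B * Y + Y * B = (2 : ℂ) • (A * Y + D * Y) := by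
    rw [hBD, add_mul, mul_add, ← hAY, ← hcY, two_smul]
  have hid : (A * Y + D * Y) * (A * Y + D * Y) = A * Y + D * Y := by
    have := (h Y).1 (by rw [hTA, smul_mul_smul_comm, hE, smul_smul])
    rw [hTB, smul_mul_smul_comm, smul_smul] at this
    exact smul_right_injective _ (by norm_num : (2 * 2 : ℂ) ≠ 0) this
  have hES : (A * Y) * (D * Y) = D * Y := by
    rw [← mul_assoc, ← hcE, mul_assoc, hEY]
  have hSE : (D * Y) * (A * Y) = D * Y := by rw [mul_assoc, hY]
  have hSS : (D * Y) * (D * Y) = - (D * Y) := by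
    rw [add_mul, mul_add, mul_add, hE, hES, hSE] at hid
    have e : A * Y + D * Y + (D * Y + D * Y * (D * Y)) - (A * Y + D * Y) = 0 := by
      rw [hid, sub_self]
    rw [eq_neg_iff_add_eq_zero, ← e]; abel
  have hS : D * Y = 0 := by
    ext y
    by_contra hy
    have hy' : (D * Y) y ≠ 0 := hy
    obtain ⟨g, l, hv, hl⟩ := exists_eig hy' p.natDegree hp rfl (by rw [hA]; simp)
    have hgY : aeval A g * Y = Y * aeval A g := by
      have := congrArg (aeval A) (mul_comm g u); simpa using this
    have hSg : (D * Y) * aeval A g = aeval A g * (D * Y) := by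
      rw [mul_assoc, ← hgY, ← mul_assoc, hcg g, mul_assoc]
    set v := aeval A g ((D * Y) y) with hvdef
    have hSv : (D * Y) v = - v := by
      have e1 : (D * Y) v = ((D * Y) * aeval A g * (D * Y)) y := rfl
      rw [e1, hSg, mul_assoc, hSS]
      simp [hvdef]
    have hEv : (A * Y) v = v := by
      have e1 : (A * Y) ((D * Y) v) = (D * Y) v := by
        conv_rhs => rw [← hES]
        rfl
      rw [hSv, map_neg] at e1
      exact neg_injective e1
    by_cases hl0 : l = 0
    · have : (A * Y) v = 0 := by
        rw [hAY]; change Y (A v) = 0; rw [hl, hl0]; simp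
      exact hv (hEv.symm.trans this)
    · have hB := h.eig hl0 hl
      have hDv : D v = 0 := by rw [hD]; simp [hB, hl]
      have : (D * Y) v = 0 := by rw [hcY]; change Y (D v) = 0; rw [hDv, map_zero]
      rw [hSv] at this
      exact hv (neg_eq_zero.1 this)
  rw [hAY, ← mul_assoc, hS, zero_mul]

/-- value of `B²` from `D x` -/
lemma sq_formula {A B : X →L[ℂ] X} (hc : (B - A) * A = A * (B - A)) {x : X} {a b : ℂ}
    (e : (B - A) x = a • x + b • A (A x)) :
    B (B x) = (a * a) • x + (2 * a) • A x + (1 + 2 * a * b) • A (A x) + (2 * b) • A (A (A x))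
      + (b * b) • A (A (A (A x))) := by
  have hc' : ∀ y, (B - A) (A y) = A ((B - A) y) := fun y => congrArg (fun T : X →L[ℂ] X => T y) hc
  have hB : ∀ y, B y = A y + (B - A) y := fun y => by simp
  rw [hB x, e, hB (A x + _)]
  simp only [map_add, map_smul, hc', e]
  module

lemma JH.alg_case {A B : X →L[ℂ] X} (h : JH A B) (hc : (B - A) * A = A * (B - A))
    {p : ℂ[X]} (hp : p.Monic) {m : ℕ} (hm : p.natDegree = m) (h3 : m = 3 ∨ m = 4)
    (hA : aeval A p = 0) {x : X} (hx : GI A m x) : (B - A) x = 0 := by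
  obtain ⟨k, q, u, hpq, hE, hY, hk⟩ := drazin hp.ne_zero hA
  have hDE := h.drazin_zero hc hp.ne_zero hA hE hY
  have hx3 : GI A 3 x := hx.mono (by omega)
  obtain ⟨⟨a, b, e⟩, ⟨a', b', e'⟩⟩ := h.range hx3.notMem
  have hsq := sq_formula hc e
  have hcY := comm_aeval hc u
  have hAY : A * aeval A u = aeval A u * A := comm_aeval rfl u
  have hBD : ∀ y, B y = A y + (B - A) y := fun y => by simp
  have hc' : ∀ y, (B - A) (A y) = A ((B - A) y) := fun y => congrArg (fun T : X →L[ℂ] X => T y) hc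
  set D := B - A with hD
  set Y := aeval A u with hYdef
  have hcE : D * (A * Y) = (A * Y) * D := by
    rw [← mul_assoc, hc, mul_assoc, hcY, mul_assoc]
  have hcEA : A * (A * Y) = (A * Y) * A := by
    rw [mul_assoc, ← hAY]
  set E := A * Y with hEdef
  have hED : E * D = 0 := by rw [← hcE, hDE]
  have hEx : E (D x) = 0 := by
    change (E * D) x = 0; rw [hED]; rfl
  have hcEA' : ∀ y, A (E y) = E (A y) := fun y => congrArg (fun T : X →L[ℂ] X => T y) hcEA
  by_cases hz : x - E x = 0
  · have : x = E x := sub_eq_zero.1 hz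
    rw [this]; change (D * E) x = 0; rw [hDE]; rfl
  set z := x - E x with hzdef
  have hDz : D z = a • z + b • A (A z) := by
    have h1 : D z = D x - E (D x) := by
      rw [hzdef, map_sub]; congr 1
      exact congrArg (fun T : X →L[ℂ] X => T x) hcE
    rw [h1, e, hzdef]
    simp only [map_add, map_sub, map_smul, hcEA']
    module
  have hkz : (A ^ k) z = 0 := by
    have := congrArg (fun T : X →L[ℂ] X => T x) hk
    simpa [hzdef] using this
  -- last nonzero iterate
  obtain ⟨v, hv, hAv, hDv⟩ : ∃ v, v ≠ 0 ∧ A v = 0 ∧ D v = a • v := by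
    classical
    have hex : ∃ n, (A ^ n) z = 0 := ⟨k, hkz⟩
    have hn := Nat.find_spec hex
    have hlt := fun j (hj : j < Nat.find hex) => Nat.find_min hex hj
    have hpos : Nat.find hex ≠ 0 := by
      intro h0; rw [h0] at hn; exact hz (by simpa using hn)
    obtain ⟨n, hn'⟩ := Nat.exists_eq_succ_of_ne_zero hpos
    rw [hn'] at hn hlt
    have hAv : A ((A ^ n) z) = 0 := by
      rw [Nat.succ_eq_add_one, pow_succ'] at hn; exact hn
    refine ⟨(A ^ n) z, hlt n (Nat.lt_succ_self n), hAv, ?_⟩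
    have hcn : D * A ^ n = A ^ n * D := (show Commute D A from hc).pow_right n
    have hcAn : A ^ n * A = A * A ^ n := by rw [← pow_succ, ← pow_succ']
    have e1 : D ((A ^ n) z) = (A ^ n) (D z) := congrArg (fun T : X →L[ℂ] X => T z) hcn
    have e2 : (A ^ n) (A (A z)) = A ((A ^ n) (A z)) :=
      congrArg (fun T : X →L[ℂ] X => T (A z)) hcAn
    have e3 : (A ^ n) (A z) = A ((A ^ n) z) := congrArg (fun T : X →L[ℂ] X => T z) hcAn
    rw [e1, hDz, map_add, map_smul, map_smul, e2, e3, hAv]; simp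
  have ha : a = 0 := by
    by_contra ha
    have := h.symm.eig ha (x := v) (by rw [hBD, hAv, hDv, zero_add])
    rw [hAv] at this
    exact smul_ne_zero ha hv this.symm
  subst ha
  by_cases hb : b = 0
  · rw [e, hb]; simp
  exfalso
  have hDx : D x = b • A (A x) := by rw [e]; simp
  have hEx0 : E x = 0 := by
    have h1 : E (A (A x)) = 0 := by
      rw [hDx, map_smul] at hEx; exact (smul_eq_zero.1 hEx).resolve_left hb
    have h2 : Y (Y (A (A x))) = E x := by
      have : Y * Y * A * A = E := by
        rw [mul_assoc Y Y A, ← hAY, hY, ← hAY]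
      exact congrArg (fun T : X →L[ℂ] X => T x) this
    have h3 : E (E x) = E x := congrArg (fun T : X →L[ℂ] X => T x) hE
    have hEY : E * (Y * Y) = Y * Y * E := by
      have hEY0 : E * Y = Y := by rw [hAY, mul_assoc, ← hEdef, hY]
      rw [← mul_assoc, hEY0, mul_assoc, hY]
    rw [← h3, ← h2]
    have := congrArg (fun T : X →L[ℂ] X => T (A (A x))) hEY
    simp only [mul_apply_eq_comp] at this
    rw [this, h1]; simp
  have hzx : z = x := by rw [hzdef, hEx0, sub_zero]
  rw [hzx] at hkz
  have hkm : m ≤ k := by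
    by_contra hlt
    push Not at hlt
    have := LinearIndependent.ne_zero (⟨k, hlt⟩ : Fin m) hx
    exact this hkz
  have hq0 : q ≠ 0 := by rintro rfl; exact hp.ne_zero (by rw [hpq, mul_zero])
  have hdeg : m = k + q.natDegree := by
    rw [← hm, hpq, natDegree_mul (pow_ne_zero _ X_ne_zero) hq0, natDegree_X_pow]
  have hkm' : k = m := by omega
  have hAm : A ^ m = 0 := by
    have hqd : q.natDegree = 0 := by omega
    rw [eq_C_of_natDegree_eq_zero hqd] at hpq hq0
    rw [hpq, hkm'] at hA
    have hc0 : q.coeff 0 ≠ 0 := by simpa using hq0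
    simpa [Algebra.algebraMap_eq_smul_one, hc0] using hA
  rcases h3 with h3 | h3
  · subst h3
    have hA3 : ∀ y, A (A (A y)) = 0 := fun y => by
      have := congrArg (fun T : X →L[ℂ] X => T y) hAm
      simpa [pow_succ] using this
    have hAAx : A (A x) ≠ 0 := by
      intro h0
      have := hx3.three (a := 0) (b := 0) (c := 1) (by simp [h0])
      exact one_ne_zero this.2.2
    obtain ⟨f, -, hf⟩ := hb_sep (⊥ : Submodule ℂ X) (A (A x)) (by simpa using hAAx)
    let Z : X →L[ℂ] X := (f.comp (A * A)).smulRight x - (f.comp A).smulRight (A x)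
      + f.smulRight (A (A x))
    have hZ : ∀ y, Z y = f (A (A y)) • x - f (A y) • A x + f y • A (A x) := fun y => by
      simp [Z]
    have h0 : A * Z + Z * A = 0 := by
      ext y
      simp only [add_apply, mul_apply_eq_comp, hZ, map_add, map_sub, map_smul, hA3]
      simp
    have h1 := congrArg (fun T : X →L[ℂ] X => T x) (h.zero h0)
    have h0' := congrArg (fun T : X →L[ℂ] X => T x) h0
    simp only [add_apply, mul_apply_eq_comp, zero_apply] at h1 h0'
    have h2 : D (Z x) + Z (D x) = 0 := by
      rw [hBD, hBD x, map_add] at h1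
      linear_combination (norm := module) h1 - h0'
    rw [hDx, map_smul, hZ x, hZ (A (A x)), map_add, map_sub, map_smul, map_smul, map_smul,
      hc', hc', hc', hDx] at h2
    simp [hA3, hf, hb] at h2
    rw [← two_smul ℂ] at h2
    simp [hb, hAAx] at h2
  · subst h3
    have hA4 : A (A (A (A x))) = 0 := by
      have := congrArg (fun T : X →L[ℂ] X => T x) hAm
      simpa [pow_succ] using this
    rw [e', hA4] at hsq
    have := hx.four (a := -a') (b := 0) (c := 1 - b') (d := 2 * b)
      (by linear_combination (norm := module) -hsq)
    exact hb (by simpa using this.2.2.2)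

theorem JH.of_three {A B : X →L[ℂ] X} (h : JH A B) {x : X} (hx : GI A 3 x) : A = B := by
  have hc := h.comm hx
  suffices hD : B - A = 0 from (sub_eq_zero.1 hD).symm
  by_cases h5 : ∃ y, GI A 5 y
  · obtain ⟨y, hy⟩ := h5
    refine hy.eq_zero (fun w hw => ?_)
    obtain ⟨⟨a, b, e⟩, ⟨a', b', e'⟩⟩ := h.range (hw.mono (by norm_num : 3 ≤ 5)).notMem
    have hsq := sq_formula hc e
    rw [e'] at hsq
    have := hw.five (a := a * a - a') (b := 2 * a) (c := 1 + 2 * a * b - b') (d := 2 * b)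
      (e' := b * b) (by linear_combination (norm := module) -hsq)
    have ha : a = 0 := by simpa using this.2.1
    have hb : b = 0 := by simpa using this.2.2.2.1
    rw [e, ha, hb]; simp
  push Not at h5
  by_cases h4 : ∃ y, GI A 4 y
  · obtain ⟨y, hy⟩ := h4
    obtain ⟨p, hp, hd, hA⟩ := kaplansky hy h5
    exact hy.eq_zero (fun w hw => h.alg_case hc hp hd (Or.inr rfl) hA hw)
  push Not at h4
  obtain ⟨p, hp, hd, hA⟩ := kaplansky hx h4
  exact hx.eq_zero (fun w hw => h.alg_case hc hp hd (Or.inl rfl) hA hw)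

theorem JH.of_scalar {A B : X →L[ℂ] X} (h : JH A B) {c : ℂ} (hA : ∀ y, A y = c • y) : A = B := by
  by_cases hc : c = 0
  · have hA0 : A = 0 := by ext y; simp [hA, hc]
    have := h.zero (Y := 1) (by simp [hA0])
    rw [hA0]
    have h2 : (2 : ℂ) • B = 0 := by rw [two_smul]; simpa using this
    exact ((smul_eq_zero.1 h2).resolve_left two_ne_zero).symm
  · ext y
    rw [hA, h.eig hc (hA y)]

/-- `A² = q` with `A` not scalar -/
theorem JH.of_sq {A B : X →L[ℂ] X} (h : JH A B) {q : ℂ} (hA : ∀ y, A (A y) = q • y) {x : X}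
    (hx : GI A 2 x) : A = B := by
  suffices hD : B - A = 0 from (sub_eq_zero.1 hD).symm
  have key : ∀ y, GI A 2 y → (∃ a : ℂ, (B - A) y = a • y) ∧ ∃ a : ℂ, B (B y) = a • y := by
    intro y hy
    have hn : A y ∉ Submodule.span ℂ {y, A (A y)} := by
      intro hm
      obtain ⟨a, b, e⟩ := Submodule.mem_span_pair.1 hm
      rw [hA] at e
      have := hy.two (a := a + b * q) (b := -1) (by linear_combination (norm := module) e)
      exact absurd this.2 (by norm_num)
    obtain ⟨⟨a, b, e⟩, ⟨a', b', e'⟩⟩ := h.range hn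
    rw [hA] at e e'
    exact ⟨⟨a + b * q, by rw [e]; module⟩, ⟨a' + b' * q, by rw [e']; module⟩⟩
  refine hx.eq_zero (fun y hy => ?_)
  obtain ⟨⟨a, e⟩, ⟨a', e'⟩⟩ := key y hy
  obtain ⟨t, ht, h1, h2⟩ := exists_two (hy.line (A y))
  obtain ⟨⟨a1, e1⟩, -⟩ := key _ h1
  obtain ⟨⟨a2, e2⟩, -⟩ := key _ h2
  have hB : ∀ y, B y = A y + (B - A) y := fun y => by simp
  set D := B - A
  rw [map_add, map_smul, e] at e1 e2
  have e3 := hy.two (a := 2 * (a1 - a) - (a2 - a)) (b := 2 * t * a1 - 2 * t * a2) (by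
    linear_combination (norm := module) e2 - (2 : ℂ) • e1)
  have h12 : a1 = a2 := by
    apply mul_left_cancel₀ (mul_ne_zero two_ne_zero ht); linear_combination e3.2
  have h1a : a1 = a := by linear_combination e3.1 - h12
  rw [h1a] at e1
  have e4 : D (A y) = a • A y := by
    have : t • (D (A y) - a • A y) = 0 := by linear_combination (norm := module) e1
    exact sub_eq_zero.1 ((smul_eq_zero.1 this).resolve_left ht)
  have e5 : B (B y) = (q + a * a) • y + (2 * a) • A y := by
    rw [hB y, e, hB (A y + _)]
    simp only [map_add, map_smul, e, e4, hA]
    module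
  rw [e'] at e5
  have := hy.two (a := q + a * a - a') (b := 2 * a) (by linear_combination (norm := module) -e5)
  have ha : a = 0 := by simpa using this.2
  rw [e, ha, zero_smul]

/-- eigen-information in the quadratic case -/
lemma JH.quad {A B : X →L[ℂ] X} (h : JH A B) {l m : ℂ} (hl : l ≠ 0)
    (hA : ∀ y, A (A y) = (l + m) • A y - (l * m) • y) :
    (∀ y, (B - A) (A y) = m • (B - A) y) ∧ (∀ y, A ((B - A) y) = m • (B - A) y) := by
  constructor
  · intro y
    have h1 : A (A y - m • y) = l • (A y - m • y) := by
      rw [map_sub, map_smul, hA]; module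
    have h2 := h.eig hl h1
    have h3 : (B - A) (A y - m • y) = 0 := by rw [sub_apply, h2, h1, sub_self]
    rw [map_sub, map_smul] at h3
    exact sub_eq_zero.1 h3
  · intro y
    by_contra hne
    have hne' : A ((B - A) y) - m • (B - A) y ∉ (⊥ : Submodule ℂ X) := by
      simpa [sub_eq_zero] using hne
    obtain ⟨g, -, hg⟩ := hb_sep _ _ hne'
    have h1 := h.coeig (f := g.comp (A - m • (1 : X →L[ℂ] X))) hl (by
      intro y
      simp [hA]
      ring) y
    have h2 : (g.comp (A - m • (1 : X →L[ℂ] X))) (A y) = l * (g.comp (A - m • (1 : X →L[ℂ] X))) y := by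
      simp [hA]
      ring
    rw [← h2, ← sub_eq_zero, ← map_sub] at h1
    have h3 : g (A ((B - A) y) - m • (B - A) y) = 0 := by simpa using h1
    rw [hg] at h3
    exact one_ne_zero h3

/-- invertible quadratic case -/
theorem JH.of_inv {A B : X →L[ℂ] X} (h : JH A B) {l m : ℂ} (hl : l ≠ 0) (hm : m ≠ 0)
    (hA : ∀ y, A (A y) = (l + m) • A y - (l * m) • y) : A = B := by
  obtain ⟨q1, q2⟩ := h.quad hl hA
  suffices hD : B - A = 0 from (sub_eq_zero.1 hD).symm
  have hB : ∀ y, B y = A y + (B - A) y := fun y => by simp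
  set D := B - A with hD
  let Y : X →L[ℂ] X := (l * m)⁻¹ • ((l + m) • (1 : X →L[ℂ] X) - A)
  have hY : ∀ y, Y y = (l * m)⁻¹ • ((l + m) • y - A y) := fun y => by simp [Y]
  have hlm : l * m ≠ 0 := mul_ne_zero hl hm
  have hAY : ∀ y, A (Y y) = y := fun y => by
    rw [hY, map_smul, map_sub, map_smul, hA, sub_sub_cancel, smul_smul, inv_mul_cancel₀ hlm,
      one_smul]
  have hYA : ∀ y, Y (A y) = y := fun y => by
    rw [hY, hA, sub_sub_cancel, smul_smul, inv_mul_cancel₀ hlm, one_smul]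
  have hDY : ∀ y, D (Y y) = m⁻¹ • D y := fun y => by
    rw [hY, map_smul, map_sub, map_smul, q1, ← sub_smul, smul_smul]
    congr 1; field_simp; ring
  have hYD : ∀ y, Y (D y) = m⁻¹ • D y := fun y => by
    rw [hY, q2, ← sub_smul, smul_smul]
    congr 1; field_simp; ring
  have hDD : ∀ y, D (D y) = 0 := fun y => by
    have := h.eig hm (q2 y)
    rw [hD, sub_apply, ← hD, this, q2, sub_self]
  have hid := (h Y).1 (by
    ext y
    simp only [mul_apply_eq_comp, add_apply, smul_apply, hAY, hYA, map_add]
    module)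
  ext y
  have := congrArg (fun T : X →L[ℂ] X => T y) hid
  have hT : ∀ y, (B * Y + Y * B) y = (2 : ℂ) • y + (2 * m⁻¹) • D y := fun y => by
    rw [add_apply, mul_apply_eq_comp, mul_apply_eq_comp, hB (Y y), hB y, map_add, hAY, hYA, hDY,
      hYD]
    module
  rw [mul_apply_eq_comp, smul_apply, hT (_ : X), hT y] at this
  simp only [map_add, map_smul, hDD] at this
  have h4 : (4 * m⁻¹ : ℂ) • D y = 0 := by
    linear_combination (norm := module) this
  simpa [hm] using h4

theorem JH.main {A B : X →L[ℂ] X} (h : JH A B) : A = B := by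
  by_cases hA3 : ∃ x, GI A 3 x
  · exact h.of_three hA3.choose_spec
  by_cases hB3 : ∃ x, GI B 3 x
  · exact (h.symm.of_three hB3.choose_spec).symm
  push Not at hA3 hB3
  -- each of them is scalar or quadratic
  have dich : ∀ T : X →L[ℂ] X, (∀ x, ¬ GI T 3 x) → (∃ c : ℂ, ∀ y, T y = c • y) ∨
      ((∃ x, GI T 2 x) ∧ ∃ l m : ℂ, ∀ y, T (T y) = (l + m) • T y - (l * m) • y) := by
    intro T hT
    by_cases h2 : ∃ x, GI T 2 x
    · right
      refine ⟨h2, ?_⟩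
      obtain ⟨x, hx⟩ := h2
      obtain ⟨p, hp, hd, hTp⟩ := kaplansky hx hT
      have hs := (IsAlgClosed.splits p).eq_prod_roots_of_monic hp
      have hcard : p.roots.card = 2 := by
        rw [← hd]; exact (splits_iff_card_roots.1 (IsAlgClosed.splits p))
      obtain ⟨l, m, hlm⟩ := Multiset.card_eq_two.1 hcard
      refine ⟨l, m, fun y => ?_⟩
      rw [hlm] at hs
      rw [hs] at hTp
      have := congrArg (fun S : X →L[ℂ] X => S y) hTp
      simp [Algebra.algebraMap_eq_smul_one] at this
      linear_combination (norm := module) this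
    · left
      push Not at h2
      by_cases h1 : ∃ x, GI T 1 x
      · obtain ⟨x, hx⟩ := h1
        obtain ⟨p, hp, hd, hTp⟩ := kaplansky hx h2
        have hs := (IsAlgClosed.splits p).eq_prod_roots_of_monic hp
        have hcard : p.roots.card = 1 := by
          rw [← hd]; exact (splits_iff_card_roots.1 (IsAlgClosed.splits p))
        obtain ⟨l, hl⟩ := Multiset.card_eq_one.1 hcard
        refine ⟨l, fun y => ?_⟩
        rw [hl] at hs
        rw [hs] at hTp
        have := congrArg (fun S : X →L[ℂ] X => S y) hTp
        simp [Algebra.algebraMap_eq_smul_one] at this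
        linear_combination (norm := module) this
      · push Not at h1
        refine ⟨0, fun y => ?_⟩
        have hy : y = 0 := by
          by_contra hy
          apply h1 y
          unfold GI
          rw [Fintype.linearIndependent_iff]
          intro g hg i
          fin_cases i
          simpa [hy] using hg
        simp [hy]
  rcases dich A hA3 with ⟨c, hc⟩ | ⟨⟨x, hx⟩, l, m, hA⟩
  · exact h.of_scalar hc
  rcases dich B hB3 with ⟨c, hc⟩ | ⟨⟨x', hx'⟩, l', m', hB⟩
  · exact (h.symm.of_scalar hc).symm
  by_cases hp : l + m = 0
  · exact h.of_sq (q := -(l * m)) (fun y => by rw [hA, hp]; module) hx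
  by_cases hp' : l' + m' = 0
  · exact (h.symm.of_sq (q := -(l' * m')) (fun y => by rw [hB, hp']; module) hx').symm
  by_cases hq : l * m = 0
  swap
  · exact h.of_inv (left_ne_zero_of_mul hq) (right_ne_zero_of_mul hq) hA
  by_cases hq' : l' * m' = 0
  swap
  · exact (h.symm.of_inv (left_ne_zero_of_mul hq') (right_ne_zero_of_mul hq') hB).symm
  obtain ⟨a1, a2⟩ := h.quad (l := l + m) (m := 0) hp (fun y => by rw [hA, hq]; module)
  obtain ⟨b1, b2⟩ := h.symm.quad (l := l' + m') (m := 0) hp' (fun y => by rw [hB, hq']; module)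
  have hA' : ∀ y, A (A y) = (l + m) • A y := fun y => by rw [hA, hq]; module
  have hB' : ∀ y, B (B y) = (l' + m') • B y := fun y => by rw [hB, hq']; module
  -- `BA = AB = A² = B²`
  have hAB : ∀ y, A (A y) = B (B y) := fun y => by
    have e1 := a1 y
    have e2 := b2 y
    simp only [sub_apply, map_sub, zero_smul, sub_eq_zero] at e1 e2
    rw [← e1, e2]
  have hx0 : A x ≠ 0 := fun h0 => by
    have := hx.two (a := 0) (b := 1) (by simp [h0])
    exact one_ne_zero this.2
  set p := l + m
  set p' := l' + m'
  have e1 : ∀ y, p • A y = p' • B y := fun y => by rw [← hA', ← hB', hAB]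
  have e2 : B (A x) = A (A x) := by
    have := a1 x
    simpa [sub_eq_zero] using this
  have e3 := e1 (A x)
  rw [e2, hA', smul_smul, smul_smul, ← sub_eq_zero, ← sub_smul] at e3
  have e4 := (smul_eq_zero.1 e3).resolve_right hx0
  have e5 : p = p' := mul_right_cancel₀ hp (by linear_combination e4)
  ext y
  have := e1 y
  rw [← e5] at this
  exact smul_right_injective _ hp this
end Aux

theorem stmt_19 {X : Type*} [NormedAddCommGroup X] [NormedSpace ℂ X] [CompleteSpace X]
    (hdim : 3 ≤ Module.rank ℂ X)
    (A B : X →L[ℂ] X) :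
    A = B ↔ ∀ Y : X →L[ℂ] X,
      (IsIdempotentElem ((2⁻¹ : ℂ) • (A * Y + Y * A)) ↔
        IsIdempotentElem ((2⁻¹ : ℂ) • (B * Y + Y * B))) := by
  constructor
  · rintro rfl Y; exact Iff.rfl
  · intro h
    refine JH.main (fun Y => ?_)
    rw [← idem_iff, ← idem_iff]
    exact h Y
end
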